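/- arXiv:0708.2155 — 2 statements merged into one kernel-verified Lean document; each statement's English description precedes it below -/
import Mathlib

section
/- Let m, r ≥ 1 be integers and let W ⊆ ℂ^m be an open neighborhood of 0. Let h = (h_{ρσ}) : W → Matrix(r,r,ℂ) be a C² map such that h(z) is a Hermitian matrix for every z ∈ W, h(0) is the identity matrix, and the real Fréchet derivative of h at 0 vanishes. Define φ : W × ℂ^r → ℝ by φ(z, ξ) = Σ_{ρ,σ=1}^r h_{ρσ}(z) ξ_σ conj(ξ_ρ) (a real number since h(z) is Hermitian). Then for every ξ₀ ∈ ℂ^r and every (η, ζ) ∈ ℂ^m × ℂ^r, the Levi form of φ at the point (0, ξ₀) satisfies L_φ((0,ξ₀); (η,ζ)) = Σ_{ρ=1}^r |ζ_ρ|² + Σ_{ρ,σ=1}^r Σ_{i,j=1}^m (∂²h_{ρσ}/∂z_i∂z̄_j)(0) · ξ₀_σ · conj(ξ₀_ρ) · η_i · conj(η_j). -/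
open Set Metric Complex Bornology

noncomputable section

/-- The Levi form of a C² function `ρ` at `x` in direction `v`:
`L_ρ(x;v) = (1/4)(D²ρ(x)[v,v] + D²ρ(x)[iv,iv])`. -/
def leviForm {E : Type*} [NormedAddCommGroup E] [NormedSpace ℂ E]
    (ρ : E → ℝ) (x v : E) : ℝ :=
  (1 / 4) * (iteratedFDeriv ℝ 2 ρ x ![v, v] +
    iteratedFDeriv ℝ 2 ρ x ![Complex.I • v, Complex.I • v])

/-- The Levi form of `ρ` at `x` has at least `r` positive eigenvalues: there is an
`r`-dimensional complex subspace on which it is positive on nonzero vectors. -/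
def LeviPosEigenAtLeast {E : Type*} [NormedAddCommGroup E] [NormedSpace ℂ E]
    (ρ : E → ℝ) (x : E) (r : ℕ) : Prop :=
  ∃ V : Submodule ℂ E, Module.finrank ℂ V = r ∧ ∀ v ∈ V, v ≠ 0 → 0 < leviForm ρ x v

/-- A bounded strongly pseudoconvex domain in `ℂ^d` with boundary of class `C^ℓ`. -/
def IsSPCDomain {d : ℕ} (D : Set (EuclideanSpace ℂ (Fin d))) (ℓ : ℕ∞) : Prop :=
  IsOpen D ∧ IsConnected D ∧ IsBounded D ∧
  ∃ (U : Set (EuclideanSpace ℂ (Fin d))) (rD : EuclideanSpace ℂ (Fin d) → ℝ),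
    IsOpen U ∧ frontier D ⊆ U ∧ ContDiffOn ℝ ℓ rD U ∧
    D ∩ U = {x ∈ U | rD x < 0} ∧
    (∀ x ∈ frontier D, fderiv ℝ rD x ≠ 0) ∧
    (∀ x ∈ frontier D, ∀ v : EuclideanSpace ℂ (Fin d), v ≠ 0 →
      fderiv ℝ rD x v = 0 → fderiv ℝ rD x (Complex.I • v) = 0 → 0 < leviForm rD x v)

/-- The Wirtinger derivative `∂f/∂z_i`, computed from the real Fréchet derivative. -/
def wDz {m : ℕ} (i : Fin m) (f : EuclideanSpace ℂ (Fin m) → ℂ) :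
    EuclideanSpace ℂ (Fin m) → ℂ := fun x =>
  (1 / 2) * (fderiv ℝ f x (EuclideanSpace.single i 1)
    - Complex.I * fderiv ℝ f x (Complex.I • EuclideanSpace.single i 1))

/-- The Wirtinger derivative `∂f/∂z̄_j`, computed from the real Fréchet derivative. -/
def wDzbar {m : ℕ} (j : Fin m) (f : EuclideanSpace ℂ (Fin m) → ℂ) :
    EuclideanSpace ℂ (Fin m) → ℂ := fun x =>
  (1 / 2) * (fderiv ℝ f x (EuclideanSpace.single j 1)
    + Complex.I * fderiv ℝ f x (Complex.I • EuclideanSpace.single j 1))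

/-- The squared-norm function `φ(z,ξ) = Σ_{ρ,σ} h_{ρσ}(z) ξ_σ ξ̄_ρ` of a Hermitian
metric `h`, as a real-valued function (real since `h(z)` is a Hermitian matrix). -/
def sqNormFun {m r : ℕ} (h : EuclideanSpace ℂ (Fin m) → Fin r → Fin r → ℂ)
    (p : EuclideanSpace ℂ (Fin m) × EuclideanSpace ℂ (Fin r)) : ℝ :=
  (∑ ρ : Fin r, ∑ σ : Fin r,
    h p.1 ρ σ * p.2 σ * (starRingEnd ℂ) (p.2 ρ)).re

section SecondDerivative

variable {E F : Type*} [NormedAddCommGroup E] [NormedSpace ℝ E]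
  [NormedAddCommGroup F] [NormedSpace ℝ F]

lemma ContDiffAt.eventually_differentiableAt_of_two {f : E → F} {x : E}
    (hf : ContDiffAt ℝ 2 f x) : ∀ᶠ y in nhds x, DifferentiableAt ℝ f y :=
  (hf.eventually (by simp)).mono fun _ hy => hy.differentiableAt two_ne_zero

lemma ContDiffAt.differentiableAt_fderiv_of_two {f : E → F} {x : E}
    (hf : ContDiffAt ℝ 2 f x) : DifferentiableAt ℝ (fderiv ℝ f) x :=
  (hf.fderiv_right (m := 1) (by norm_num)).differentiableAt one_ne_zero

lemma fderiv_fderiv_fun_sum {ι : Type*} (s : Finset ι) {f : ι → E → F} {x : E}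
    (hf : ∀ i ∈ s, ContDiffAt ℝ 2 (f i) x) :
    fderiv ℝ (fderiv ℝ (fun y => ∑ i ∈ s, f i y)) x =
      ∑ i ∈ s, fderiv ℝ (fderiv ℝ (f i)) x := by
  have key : fderiv ℝ (fun y => ∑ i ∈ s, f i y) =ᶠ[nhds x]
      fun y => ∑ i ∈ s, fderiv ℝ (f i) y := by
    filter_upwards [(Filter.eventually_all_finset s).2
      fun i hi => (hf i hi).eventually_differentiableAt_of_two] with y hy
    exact fderiv_fun_sum hy
  rw [key.fderiv_eq]
  exact fderiv_fun_sum fun i hi => (hf i hi).differentiableAt_fderiv_of_two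

lemma fderiv_fderiv_fun_mul {f g : E → ℂ} {x : E}
    (hf : ContDiffAt ℝ 2 f x) (hg : ContDiffAt ℝ 2 g x) (v w : E) :
    fderiv ℝ (fderiv ℝ (fun y => f y * g y)) x v w =
      f x * fderiv ℝ (fderiv ℝ g) x v w + fderiv ℝ f x v * fderiv ℝ g x w +
        (g x * fderiv ℝ (fderiv ℝ f) x v w + fderiv ℝ g x v * fderiv ℝ f x w) := by
  have key : fderiv ℝ (fun y => f y * g y) =ᶠ[nhds x]
      fun y => f y • fderiv ℝ g y + g y • fderiv ℝ f y := by
    filter_upwards [hf.eventually_differentiableAt_of_two,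
      hg.eventually_differentiableAt_of_two] with y hfy hgy
    exact fderiv_fun_mul hfy hgy
  have hf₀ := hf.differentiableAt two_ne_zero
  have hg₀ := hg.differentiableAt two_ne_zero
  have hf₁ := hf.differentiableAt_fderiv_of_two
  have hg₁ := hg.differentiableAt_fderiv_of_two
  rw [key.fderiv_eq, fderiv_fun_add (hf₀.fun_smul hg₁) (hg₀.fun_smul hf₁),
    fderiv_fun_smul hf₀ hg₁, fderiv_fun_smul hg₀ hf₁]
  simp

lemma fderiv_fderiv_comp_continuousLinearMap {G : Type*} [NormedAddCommGroup G]
    [NormedSpace ℝ G] {f : F → G} (L : E →L[ℝ] F) {x : E}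
    (hf : ContDiffAt ℝ 2 f (L x)) (v w : E) :
    fderiv ℝ (fderiv ℝ (fun y => f (L y))) x v w =
      fderiv ℝ (fderiv ℝ f) (L x) (L v) (L w) := by
  have key : fderiv ℝ (fun y => f (L y)) =ᶠ[nhds x]
      fun y => (fderiv ℝ f (L y)).comp L := by
    filter_upwards [L.continuous.continuousAt.eventually
      hf.eventually_differentiableAt_of_two] with y hy
    rw [fderiv_fun_comp y hy L.differentiableAt, L.fderiv]
  have h₁ := hf.differentiableAt_fderiv_of_two
  have h₂ : HasFDerivAt (fun y => fderiv ℝ f (L y))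
      ((fderiv ℝ (fderiv ℝ f) (L x)).comp L) x :=
    h₁.hasFDerivAt.comp x L.hasFDerivAt
  rw [key.fderiv_eq, (h₂.clm_comp (hasFDerivAt_const L x)).fderiv]
  simp

lemma fderiv_fderiv_continuousLinearMap (L : E →L[ℝ] F) (x : E) :
    fderiv ℝ (fderiv ℝ L) x = 0 := by
  have : fderiv ℝ L = fun _ => L := funext fun _ => L.fderiv
  rw [this]
  simp

lemma fderiv_fderiv_continuousLinearMap_mul (L M : E →L[ℝ] ℂ) (x v w : E) :
    fderiv ℝ (fderiv ℝ (fun y => L y * M y)) x v w = L v * M w + M v * L w := by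
  rw [fderiv_fderiv_fun_mul L.contDiff.contDiffAt M.contDiff.contDiffAt]
  simp [fderiv_fderiv_continuousLinearMap]

end SecondDerivative

/-- The Levi form of a complex-valued function. -/
def complexLeviForm {E : Type*} [NormedAddCommGroup E] [NormedSpace ℂ E]
    (f : E → ℂ) (x v : E) : ℂ :=
  (1 / 4) * (fderiv ℝ (fderiv ℝ f) x v v +
    fderiv ℝ (fderiv ℝ f) x (Complex.I • v) (Complex.I • v))

section ComplexLeviForm

variable {E : Type*} [NormedAddCommGroup E] [NormedSpace ℂ E]

lemma ofReal_leviForm {φ : E → ℝ} {g : E → ℂ} {x : E} (hφ : ContDiffAt ℝ 2 φ x)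
    (h : (fun y => (φ y : ℂ)) =ᶠ[nhds x] g) (v : E) :
    (leviForm φ x v : ℂ) = complexLeviForm g x v := by
  have key (w : E) : ((iteratedFDeriv ℝ 2 φ x ![w, w] : ℝ) : ℂ) =
      fderiv ℝ (fderiv ℝ g) x w w := by
    have h₁ := Complex.ofRealCLM.iteratedFDeriv_comp_left hφ (i := 2) le_rfl
    have h₂ : iteratedFDeriv ℝ 2 g x = iteratedFDeriv ℝ 2 (Complex.ofRealCLM ∘ φ) x :=
      (h.symm.iteratedFDeriv (𝕜 := ℝ) 2).self_of_nhds
    have h₃ := iteratedFDeriv_two_apply (𝕜 := ℝ) g x ![w, w]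
    rw [h₂, h₁] at h₃
    simpa using h₃
  simp only [leviForm, complexLeviForm]
  push_cast
  rw [key, key]

lemma complexLeviForm_fun_sum {ι : Type*} (s : Finset ι) {f : ι → E → ℂ} {x : E}
    (hf : ∀ i ∈ s, ContDiffAt ℝ 2 (f i) x) (v : E) :
    complexLeviForm (fun y => ∑ i ∈ s, f i y) x v = ∑ i ∈ s, complexLeviForm (f i) x v := by
  simp only [complexLeviForm, fderiv_fderiv_fun_sum s hf, _root_.sum_apply,
    ← Finset.sum_add_distrib, Finset.mul_sum]

end ComplexLeviForm

/-- The sesquilinear polarization of the Levi form attached to a real bilinear form `B`. -/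
def leviPolarization {E : Type*} [NormedAddCommGroup E] [NormedSpace ℂ E]
    (B : E →L[ℝ] E →L[ℝ] ℂ) : E →ₗ[ℂ] E →ₗ⋆[ℂ] ℂ :=
  LinearMap.mk₂'ₛₗ (RingHom.id ℂ) (starRingEnd ℂ)
    (fun v w => (1 / 4) * (B v w + Complex.I * B v (Complex.I • w)
      - Complex.I * B (Complex.I • v) w + B (Complex.I • v) (Complex.I • w)))
    (fun v v' w => by simp only [smul_add, map_add, _root_.add_apply]; ring)
    (fun c v w => by
      have hc (u : E) : c • u = c.re • u + c.im • (Complex.I • u) := by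
        conv_lhs => rw [← Complex.re_add_im c]
        rw [add_smul, mul_smul, Complex.coe_smul, Complex.coe_smul]
      have hI : Complex.I • c • v = c.re • (Complex.I • v) - c.im • v := by
        rw [smul_comm, hc, smul_smul Complex.I Complex.I, Complex.I_mul_I, neg_one_smul,
          smul_neg, sub_eq_add_neg]
      rw [hI, hc v]
      simp only [map_add, map_sub, map_smul, _root_.add_apply,
        _root_.sub_apply, _root_.smul_apply, Complex.real_smul,
        RingHom.id_apply, smul_eq_mul]
      conv_rhs => rw [← Complex.re_add_im c]
      ring_nf
      simp only [Complex.I_sq]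
      ring)
    (fun v w w' => by simp only [smul_add, map_add]; ring)
    (fun c v w => by
      have hc (u : E) : c • u = c.re • u + c.im • (Complex.I • u) := by
        conv_lhs => rw [← Complex.re_add_im c]
        rw [add_smul, mul_smul, Complex.coe_smul, Complex.coe_smul]
      have hI : Complex.I • c • w = c.re • (Complex.I • w) - c.im • w := by
        rw [smul_comm, hc, smul_smul Complex.I Complex.I, Complex.I_mul_I, neg_one_smul,
          smul_neg, sub_eq_add_neg]
      have hconj : (starRingEnd ℂ) c = c.re - c.im * Complex.I := by
        apply Complex.ext <;> simp
      rw [hI, hc w, hconj]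
      simp only [map_add, map_sub, map_smul, Complex.real_smul, smul_eq_mul]
      ring_nf
      simp only [Complex.I_sq]
      ring)

lemma leviPolarization_apply {E : Type*} [NormedAddCommGroup E] [NormedSpace ℂ E]
    (B : E →L[ℝ] E →L[ℝ] ℂ) (v w : E) :
    leviPolarization B v w = (1 / 4) * (B v w + Complex.I * B v (Complex.I • w)
      - Complex.I * B (Complex.I • v) w + B (Complex.I • v) (Complex.I • w)) :=
  rfl

lemma wDz_wDzbar_eq_leviPolarization {m : ℕ} {f : EuclideanSpace ℂ (Fin m) → ℂ}
    {x : EuclideanSpace ℂ (Fin m)} (hf : ContDiffAt ℝ 2 f x) (i j : Fin m) :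
    wDz i (wDzbar j f) x = leviPolarization (fderiv ℝ (fderiv ℝ f) x)
      (EuclideanSpace.single i 1) (EuclideanSpace.single j 1) := by
  have h₁ (e : EuclideanSpace ℂ (Fin m)) : HasFDerivAt (fun y => fderiv ℝ f y e)
      ((fderiv ℝ (fderiv ℝ f) x).flip e) x := by
    simpa using hf.differentiableAt_fderiv_of_two.hasFDerivAt.clm_apply (hasFDerivAt_const e x)
  have h₂ : HasFDerivAt (wDzbar j f) _ x :=
    ((h₁ (EuclideanSpace.single j 1)).add
      ((h₁ (Complex.I • EuclideanSpace.single j 1)).const_mul Complex.I)).const_mul (1 / 2 : ℂ)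
  simp only [wDz, h₂.fderiv, leviPolarization_apply, _root_.smul_apply,
    _root_.add_apply, ContinuousLinearMap.flip_apply, smul_eq_mul]
  ring_nf
  simp only [Complex.I_sq]
  ring

lemma complexLeviForm_eq_sum_wDz_wDzbar {m : ℕ} {f : EuclideanSpace ℂ (Fin m) → ℂ}
    {x : EuclideanSpace ℂ (Fin m)} (hf : ContDiffAt ℝ 2 f x) (η : EuclideanSpace ℂ (Fin m)) :
    complexLeviForm f x η =
      ∑ i, ∑ j, wDz i (wDzbar j f) x * η i * (starRingEnd ℂ) (η j) := by
  have hη : η = ∑ i, η i • EuclideanSpace.single i (1 : ℂ) := by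
    simpa using ((EuclideanSpace.basisFun (Fin m) ℂ).sum_repr η).symm
  have hsymm : complexLeviForm f x η = leviPolarization (fderiv ℝ (fderiv ℝ f) x) η η := by
    rw [leviPolarization_apply, complexLeviForm,
      (hf.isSymmSndFDerivAt (by simp)).eq η (Complex.I • η)]
    ring
  rw [hsymm]
  conv_lhs => rw [hη]
  simp only [map_sum, map_smul, LinearMap.sum_apply, LinearMap.smul_apply,
    LinearMap.map_smulₛₗ, wDz_wDzbar_eq_leviPolarization hf, smul_eq_mul, Finset.mul_sum]
  rw [Finset.sum_comm]
  refine Finset.sum_congr rfl fun i _ => Finset.sum_congr rfl fun j _ => ?_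
  ring

/-- The fiber coordinate `(z, ξ) ↦ ξ τ`, as a real-linear map. -/
def fiberCoord {m r : ℕ} (τ : Fin r) :
    EuclideanSpace ℂ (Fin m) × EuclideanSpace ℂ (Fin r) →L[ℝ] ℂ :=
  ((EuclideanSpace.proj τ : EuclideanSpace ℂ (Fin r) →L[ℂ] ℂ).restrictScalars ℝ).comp
    (ContinuousLinearMap.snd ℝ _ _)

lemma fiberCoord_apply {m r : ℕ} (τ : Fin r)
    (p : EuclideanSpace ℂ (Fin m) × EuclideanSpace ℂ (Fin r)) : fiberCoord τ p = p.2 τ :=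
  rfl

lemma contDiffAt_mul_coord_mul_conj {m r : ℕ} {f : EuclideanSpace ℂ (Fin m) → ℂ}
    {x : EuclideanSpace ℂ (Fin m)} (hf : ContDiffAt ℝ 2 f x) (ρ σ : Fin r)
    (ξ : EuclideanSpace ℂ (Fin r)) :
    ContDiffAt ℝ 2 (fun p : EuclideanSpace ℂ (Fin m) × EuclideanSpace ℂ (Fin r) =>
      f p.1 * p.2 σ * (starRingEnd ℂ) (p.2 ρ)) (x, ξ) := by
  have h₁ : ContDiffAt ℝ 2 (fun p : EuclideanSpace ℂ (Fin m) × EuclideanSpace ℂ (Fin r) =>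
      f p.1) (x, ξ) := ContDiffAt.comp (x, ξ) (g := f) hf contDiffAt_fst
  have h₂ (τ : Fin r) : ContDiff ℝ 2
      (fun p : EuclideanSpace ℂ (Fin m) × EuclideanSpace ℂ (Fin r) => p.2 τ) :=
    (fiberCoord τ).contDiff
  have h₃ : ContDiff ℝ 2 (fun p : EuclideanSpace ℂ (Fin m) × EuclideanSpace ℂ (Fin r) =>
      (starRingEnd ℂ) (p.2 ρ)) := Complex.conjCLE.contDiff.comp (h₂ ρ)
  exact (h₁.mul (h₂ σ).contDiffAt).mul h₃.contDiffAt

/-- Levi form of `(z, ξ) ↦ f z * ξ σ * conj (ξ ρ)` at a critical point of `f`. -/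
lemma complexLeviForm_mul_coord_mul_conj {m r : ℕ} {f : EuclideanSpace ℂ (Fin m) → ℂ}
    {x : EuclideanSpace ℂ (Fin m)} (hf : ContDiffAt ℝ 2 f x) (hd : fderiv ℝ f x = 0)
    (ρ σ : Fin r) (ξ ζ : EuclideanSpace ℂ (Fin r)) (η : EuclideanSpace ℂ (Fin m)) :
    complexLeviForm (fun p : EuclideanSpace ℂ (Fin m) × EuclideanSpace ℂ (Fin r) =>
        f p.1 * p.2 σ * (starRingEnd ℂ) (p.2 ρ)) (x, ξ) (η, ζ) =
      f x * (ζ σ * (starRingEnd ℂ) (ζ ρ)) +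
        complexLeviForm f x η * (ξ σ * (starRingEnd ℂ) (ξ ρ)) := by
  let π₁ : EuclideanSpace ℂ (Fin m) × EuclideanSpace ℂ (Fin r) →L[ℝ] EuclideanSpace ℂ (Fin m) :=
    ContinuousLinearMap.fst ℝ _ _
  let L : EuclideanSpace ℂ (Fin m) × EuclideanSpace ℂ (Fin r) →L[ℝ] ℂ := fiberCoord σ
  let M : EuclideanSpace ℂ (Fin m) × EuclideanSpace ℂ (Fin r) →L[ℝ] ℂ :=
    (Complex.conjCLE : ℂ →L[ℝ] ℂ).comp (fiberCoord ρ)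
  have hfun : (fun p : EuclideanSpace ℂ (Fin m) × EuclideanSpace ℂ (Fin r) =>
      f p.1 * p.2 σ * (starRingEnd ℂ) (p.2 ρ)) = fun p => f (π₁ p) * (L p * M p) := by
    funext p
    simp [π₁, L, M, fiberCoord_apply, mul_assoc]
  have hf' : ContDiffAt ℝ 2 (fun p => f (π₁ p)) (x, ξ) :=
    ContDiffAt.comp (x, ξ) (g := f) hf π₁.contDiff.contDiffAt
  have hg : ContDiffAt ℝ 2 (fun p => L p * M p) (x, ξ) :=
    (L.contDiff.mul M.contDiff).contDiffAt
  have hd' : fderiv ℝ (fun p => f (π₁ p)) (x, ξ) = 0 := by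
    have h₀ : HasFDerivAt f (0 : EuclideanSpace ℂ (Fin m) →L[ℝ] ℂ) (π₁ (x, ξ)) :=
      hd ▸ (hf.differentiableAt two_ne_zero).hasFDerivAt
    have h₁ : HasFDerivAt (fun p => f (π₁ p))
        ((0 : EuclideanSpace ℂ (Fin m) →L[ℝ] ℂ).comp π₁) (x, ξ) :=
      h₀.comp (x, ξ) π₁.hasFDerivAt
    rw [h₁.fderiv, ContinuousLinearMap.zero_comp]
  rw [hfun]
  simp only [complexLeviForm, fderiv_fderiv_fun_mul hf' hg, hd',
    fderiv_fderiv_comp_continuousLinearMap π₁ (x := (x, ξ)) hf,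
    fderiv_fderiv_continuousLinearMap_mul]
  simp only [π₁, L, M, ContinuousLinearMap.comp_apply, ContinuousLinearMap.coe_fst',
    fiberCoord_apply, ContinuousLinearEquiv.coe_coe, Complex.conjCLE_apply,
    _root_.zero_apply, Prod.smul_mk, PiLp.smul_apply, smul_eq_mul, map_mul,
    Complex.conj_I]
  ring_nf
  simp only [Complex.I_sq]
  ring

/-- The key curvature computation in the proof of Proposition 6.2: in a special frame
at `0`, the Levi form of the squared-norm function of a Hermitian metric splits into
the fiber term and the curvature term. -/
theorem levi_form_of_hermitian_metric_special_frame
    {m r : ℕ} (hm : 1 ≤ m) (hr : 1 ≤ r)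
    {W : Set (EuclideanSpace ℂ (Fin m))} (hW : IsOpen W)
    (h0W : (0 : EuclideanSpace ℂ (Fin m)) ∈ W)
    {h : EuclideanSpace ℂ (Fin m) → Fin r → Fin r → ℂ}
    (hC2 : ∀ ρ σ : Fin r, ContDiffOn ℝ 2 (fun z => h z ρ σ) W)
    (hherm : ∀ z ∈ W, ∀ ρ σ : Fin r, h z ρ σ = (starRingEnd ℂ) (h z σ ρ))
    (hid : ∀ ρ σ : Fin r, h 0 ρ σ = if ρ = σ then 1 else 0)
    (hd0 : ∀ ρ σ : Fin r, fderiv ℝ (fun z => h z ρ σ) 0 = 0) :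
    ∀ (ξ₀ ζ : EuclideanSpace ℂ (Fin r)) (η : EuclideanSpace ℂ (Fin m)),
      (leviForm (sqNormFun h) ((0 : EuclideanSpace ℂ (Fin m)), ξ₀) (η, ζ) : ℂ) =
        (∑ ρ : Fin r, (Complex.normSq (ζ ρ) : ℂ)) +
        ∑ ρ : Fin r, ∑ σ : Fin r, ∑ i : Fin m, ∑ j : Fin m,
          wDz i (wDzbar j (fun z => h z ρ σ)) 0 * ξ₀ σ * (starRingEnd ℂ) (ξ₀ ρ) *
            η i * (starRingEnd ℂ) (η j) := by
  intro ξ₀ ζ η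
  have hCD (ρ σ : Fin r) : ContDiffAt ℝ 2 (fun z => h z ρ σ) 0 :=
    (hC2 ρ σ).contDiffAt (hW.mem_nhds h0W)
  let G (ρ σ : Fin r) (p : EuclideanSpace ℂ (Fin m) × EuclideanSpace ℂ (Fin r)) : ℂ :=
    h p.1 ρ σ * p.2 σ * (starRingEnd ℂ) (p.2 ρ)
  have hG (ρ σ : Fin r) : ContDiffAt ℝ 2 (G ρ σ) (0, ξ₀) :=
    contDiffAt_mul_coord_mul_conj (hCD ρ σ) ρ σ ξ₀
  have hGsum (ρ : Fin r) : ContDiffAt ℝ 2 (fun p => ∑ σ, G ρ σ p) (0, ξ₀) :=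
    ContDiffAt.sum fun σ _ => hG ρ σ
  have hφ : ContDiffAt ℝ 2 (sqNormFun h) (0, ξ₀) :=
    Complex.reCLM.contDiff.contDiffAt.comp _ (ContDiffAt.sum fun ρ _ => hGsum ρ)
  have hreal : (fun p => (sqNormFun h p : ℂ)) =ᶠ[nhds (0, ξ₀)]
      fun p => ∑ ρ, ∑ σ, G ρ σ p := by
    filter_upwards [continuousAt_fst.eventually (hW.mem_nhds h0W)] with p hp
    refine Complex.conj_eq_iff_re.1 ?_
    simp only [map_sum, map_mul, Complex.conj_conj]
    rw [Finset.sum_comm]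
    refine Finset.sum_congr rfl fun ρ _ => Finset.sum_congr rfl fun σ _ => ?_
    rw [← hherm p.1 hp ρ σ]
    ring
  rw [ofReal_leviForm hφ hreal, complexLeviForm_fun_sum _ fun ρ _ => hGsum ρ]
  simp only [complexLeviForm_fun_sum _ fun σ _ => hG _ σ, G,
    complexLeviForm_mul_coord_mul_conj (hCD _ _) (hd0 _ _), Finset.sum_add_distrib, hid,
    complexLeviForm_eq_sum_wDz_wDzbar (hCD _ _), Finset.sum_mul]
  refine congrArg₂ (· + ·) ?_ ?_
  · simp [Complex.mul_conj]
  · refine Finset.sum_congr rfl fun ρ _ => Finset.sum_congr rfl fun σ _ =>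
      Finset.sum_congr rfl fun i _ => Finset.sum_congr rfl fun j _ => ?_
    ring

end
end

section
/- Let m, r ≥ 1 be integers and let W ⊆ ℂ^m be an open neighborhood of 0. Let h = (h_{ρσ}) : W → Matrix(r,r,ℂ) be a C² map such that h(z) is Hermitian for every z ∈ W, h(0) is the identity matrix, and the real Fréchet derivative of h at 0 vanishes; define φ : W × ℂ^r → ℝ by φ(z, ξ) = Σ_{ρ,σ} h_{ρσ}(z) ξ_σ conj(ξ_ρ). Fix ξ₀ ∈ ℂ^r \ {0} and let A be the m × m Hermitian matrix with entries A_{ij} = −Σ_{ρ,σ=1}^r (∂²h_{ρσ}/∂z_i∂z̄_j)(0) · ξ₀_σ · conj(ξ₀_ρ). If A has exactly s positive eigenvalues and exactly t negative eigenvalues (counted with multiplicity), then the Hermitian form (η, ζ) ↦ L_φ((0,ξ₀); (η,ζ)) on ℂ^m × ℂ^r has exactly t + r positive eigenvalues, exactly s negative eigenvalues, and exactly m − s − t zero eigenvalues. -/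
open Set Metric Complex Bornology

noncomputable section

section DiagonalForms

variable {ι E : Type*} [AddCommGroup E] [Module ℂ E]

/-- The subspace of vectors whose coordinates off `P` vanish. -/
def coordSubspace (e : E ≃ₗ[ℂ] (ι → ℂ)) (P : ι → Prop) : Submodule ℂ E :=
  (⨅ k ∈ {k | ¬ P k}, LinearMap.ker (LinearMap.proj k : (ι → ℂ) →ₗ[ℂ] ℂ)).map
    (e.symm : (ι → ℂ) →ₗ[ℂ] E)

lemma mem_coordSubspace (e : E ≃ₗ[ℂ] (ι → ℂ)) (P : ι → Prop) (v : E) :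
    v ∈ coordSubspace e P ↔ ∀ k, ¬ P k → e v k = 0 := by
  simp [coordSubspace, Submodule.mem_map_equiv]

variable [Fintype ι]

lemma finrank_coordSubspace (e : E ≃ₗ[ℂ] (ι → ℂ)) (P : ι → Prop) [DecidablePred P] :
    Module.finrank ℂ (coordSubspace e P) = Fintype.card {k // P k} := by
  have hd : Disjoint {k | P k} {k | ¬ P k} := by
    rw [Set.disjoint_left]
    exact fun k hk hk' => hk' hk
  have hu : (Set.univ : Set ι) ⊆ {k | P k} ∪ {k | ¬ P k} := fun k _ => em (P k)
  rw [coordSubspace, LinearEquiv.finrank_map_eq,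
    (LinearMap.iInfKerProjEquiv ℂ (fun _ : ι => ℂ) hd hu).finrank_eq, Module.finrank_pi]
  exact Fintype.card_congr (Equiv.refl _)

lemma exists_posDef_subspace (e : E ≃ₗ[ℂ] (ι → ℂ)) (d : ι → ℝ) :
    ∃ V : Submodule ℂ E, Module.finrank ℂ V = Fintype.card {k // 0 < d k} ∧
      ∀ v ∈ V, v ≠ 0 → 0 < ∑ k, d k * ‖e v k‖ ^ 2 := by
  refine ⟨coordSubspace e (fun k => 0 < d k), finrank_coordSubspace _ _, fun v hv hv0 => ?_⟩
  rw [mem_coordSubspace] at hv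
  obtain ⟨k, hk⟩ : ∃ k, e v k ≠ 0 := by
    by_contra! hz
    exact hv0 (e.map_eq_zero_iff.1 (funext hz))
  have hdk : 0 < d k := by
    by_contra hdk
    exact hk (hv k hdk)
  refine Finset.sum_pos' (fun j _ => ?_) ⟨k, Finset.mem_univ k, by positivity⟩
  by_cases hj : 0 < d j
  · positivity
  · simp [hv j hj]

lemma finrank_le_of_posDef (e : E ≃ₗ[ℂ] (ι → ℂ)) (d : ι → ℝ) (V : Submodule ℂ E)
    (hV : ∀ v ∈ V, v ≠ 0 → 0 < ∑ k, d k * ‖e v k‖ ^ 2) :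
    Module.finrank ℂ V ≤ Fintype.card {k // 0 < d k} := by
  have : FiniteDimensional ℂ E := e.symm.finiteDimensional
  have hdisj : Disjoint V (coordSubspace e (fun k => ¬ 0 < d k)) := by
    rw [Submodule.disjoint_def]
    intro v hv hv'
    rw [mem_coordSubspace] at hv'
    by_contra hv0
    refine (hV v hv hv0).not_ge (Finset.sum_nonpos fun k _ => ?_)
    by_cases hk : 0 < d k
    · simp [hv' k (not_not.2 hk)]
    · exact mul_nonpos_of_nonpos_of_nonneg (not_lt.1 hk) (by positivity)
  have hle := Submodule.finrank_add_finrank_le_of_disjoint hdisj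
  rw [finrank_coordSubspace, e.finrank_eq, Module.finrank_pi, Fintype.card_subtype_compl] at hle
  have := Fintype.card_subtype_le (fun k => 0 < d k)
  omega

lemma coe_coordSubspace_eq_radical (e : E ≃ₗ[ℂ] (ι → ℂ)) (d : ι → ℝ) (Q : E → ℝ)
    (hQ : ∀ v, Q v = ∑ k, d k * ‖e v k‖ ^ 2) :
    (coordSubspace e (fun k => d k = 0) : Set E) =
      {v | ∀ w, Q (v + w) = Q v + Q w ∧ Q (v + Complex.I • w) = Q v + Q w} := by
  classical
  ext v
  simp only [SetLike.mem_coe, mem_coordSubspace, Set.mem_ofPred_eq]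
  constructor
  · intro hv w
    simp only [hQ, ← Finset.sum_add_distrib]
    constructor <;> refine Finset.sum_congr rfl fun k _ => ?_ <;> by_cases hk : d k = 0 <;>
      simp [hk, hv k]
  · intro hv k hk
    have h1 := (hv (e.symm (Pi.single k (e v k)))).1
    simp only [hQ, ← Finset.sum_add_distrib] at h1
    rw [← sub_eq_zero, ← Finset.sum_sub_distrib, Finset.sum_eq_single k] at h1
    · have h2 : ‖e v k + e v k‖ = 2 * ‖e v k‖ := by rw [← two_mul]; simp
      simp only [map_add, LinearEquiv.apply_symm_apply, Pi.add_apply, Pi.single_eq_same, h2] at h1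
      have h3 : d k * ‖e v k‖ ^ 2 = 0 := by linarith
      simpa [hk] using h3
    · intro j _ hj
      simp [hj]
    · simp

end DiagonalForms

section SecondDerivative

variable {E F : Type*} [NormedAddCommGroup E] [NormedSpace ℝ E]
  [NormedAddCommGroup F] [NormedSpace ℝ F]

lemma hasDerivAt_add_smul (x v : E) (t : ℝ) : HasDerivAt (fun t : ℝ => x + t • v) v t := by
  simpa using ((hasDerivAt_id t).smul_const v).const_add x

lemma ContDiffAt.eventually_hasDerivAt_line {f : E → F} {x : E} (hf : ContDiffAt ℝ 2 f x)
    (v : E) : ∀ᶠ t in nhds (0 : ℝ),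
      HasDerivAt (fun t : ℝ => f (x + t • v)) (fderiv ℝ f (x + t • v) v) t := by
  have hev : ∀ᶠ y in nhds x, ContDiffAt ℝ 2 f y := hf.eventually (by simp)
  have hc : Filter.Tendsto (fun t : ℝ => x + t • v) (nhds 0) (nhds x) := by
    have := (hasDerivAt_add_smul x v 0).continuousAt.tendsto
    simpa using this
  filter_upwards [hc.eventually hev] with t ht
  exact (ht.differentiableAt (by simp)).hasFDerivAt.comp_hasDerivAt t (hasDerivAt_add_smul x v t)

lemma ContDiffAt.hasFDerivAt_fderiv_apply {f : E → F} {x : E} (hf : ContDiffAt ℝ 2 f x) (w : E) :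
    HasFDerivAt (fun y => fderiv ℝ f y w) ((fderiv ℝ (fderiv ℝ f) x).flip w) x := by
  simpa using hf.differentiableAt_fderiv_of_two.hasFDerivAt.clm_apply (hasFDerivAt_const w x)

lemma ContDiffAt.hasDerivAt_fderiv_line {f : E → F} {x : E} (hf : ContDiffAt ℝ 2 f x) (v : E) :
    HasDerivAt (fun t : ℝ => fderiv ℝ f (x + t • v) v) (fderiv ℝ (fderiv ℝ f) x v v) 0 := by
  have hd : HasFDerivAt (fun y => fderiv ℝ f y v) ((fderiv ℝ (fderiv ℝ f) x).flip v)
      (x + (0 : ℝ) • v) := by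
    rw [zero_smul, add_zero]
    exact hf.hasFDerivAt_fderiv_apply v
  exact hd.comp_hasDerivAt (0 : ℝ) (hasDerivAt_add_smul x v 0)

lemma ContDiffAt.fderiv_fderiv_apply_add {f : E → ℂ} {x : E} (hf : ContDiffAt ℝ 2 f x)
    (a b : ℂ) (u w w' : E) :
    fderiv ℝ (fun y => a * (fderiv ℝ f y w + b * fderiv ℝ f y w')) x u =
      a * (fderiv ℝ (fderiv ℝ f) x u w + b * fderiv ℝ (fderiv ℝ f) x u w') := by
  have hd := ((hf.hasFDerivAt_fderiv_apply w).fun_add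
    ((hf.hasFDerivAt_fderiv_apply w').const_mul b)).const_mul a
  rw [hd.fderiv]
  simp [mul_add]

end SecondDerivative

lemma wDz_wDzbar_eq {m : ℕ} {f : EuclideanSpace ℂ (Fin m) → ℂ} {x : EuclideanSpace ℂ (Fin m)}
    (hf : ContDiffAt ℝ 2 f x) (i j : Fin m) :
    wDz i (wDzbar j f) x = (1 / 4) *
      (fderiv ℝ (fderiv ℝ f) x (EuclideanSpace.single i 1) (EuclideanSpace.single j 1)
      + fderiv ℝ (fderiv ℝ f) x (I • EuclideanSpace.single i 1) (I • EuclideanSpace.single j 1)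
      + I * (fderiv ℝ (fderiv ℝ f) x (EuclideanSpace.single i 1) (I • EuclideanSpace.single j 1)
      - fderiv ℝ (fderiv ℝ f) x (I • EuclideanSpace.single i 1)
          (EuclideanSpace.single j 1))) := by
  unfold wDz wDzbar
  rw [hf.fderiv_fderiv_apply_add, hf.fderiv_fderiv_apply_add]
  linear_combination (-1 / 4) * fderiv ℝ (fderiv ℝ f) x (I • EuclideanSpace.single i 1)
    (I • EuclideanSpace.single j 1) * I_mul_I

lemma complex_smul_eq {E : Type*} [AddCommGroup E] [Module ℂ E] (a : ℂ) (u : E) :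
    a • u = a.re • u + a.im • (I • u) := by
  conv_lhs => rw [← re_add_im a, add_smul, mul_smul]
  rfl

/-- The sesquilinear form whose diagonal is the Hermitian part of a symmetric real bilinear
form `B`. -/
def sesqPart {E : Type*} [NormedAddCommGroup E] [NormedSpace ℂ E] (B : E →L[ℝ] E →L[ℝ] ℂ) :
    E →ₗ[ℂ] E →ₗ⋆[ℂ] ℂ :=
  LinearMap.mk₂'ₛₗ (RingHom.id ℂ) (starRingEnd ℂ)
    (fun u w => (1 / 4) * (B u w + B (I • u) (I • w) + I * (B u (I • w) - B (I • u) w)))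
    (fun u u' w => by simp only [smul_add, map_add, _root_.add_apply]; ring)
    (fun a u w => by
      have h1 : I • a • u = a.re • (I • u) - a.im • u := by
        rw [complex_smul_eq a u, smul_add, smul_comm I a.re, smul_comm I a.im, smul_smul I I]
        simp [sub_eq_add_neg]
      rw [h1, complex_smul_eq a u]
      simp only [map_add, map_sub, map_smul, _root_.add_apply,
        _root_.sub_apply, _root_.smul_apply, real_smul, smul_eq_mul,
        RingHom.id_apply]
      conv_rhs => rw [← re_add_im a]
      linear_combination (-1 / 4) * (a.im : ℂ) * (B u (I • w) - B (I • u) w) * I_mul_I)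
    (fun u w w' => by simp only [smul_add, map_add]; ring)
    (fun a u w => by
      have h1 : I • a • w = a.re • (I • w) - a.im • w := by
        rw [complex_smul_eq a w, smul_add, smul_comm I a.re, smul_comm I a.im, smul_smul I I]
        simp [sub_eq_add_neg]
      rw [h1, complex_smul_eq a w]
      simp only [map_add, map_sub, map_smul, real_smul, smul_eq_mul]
      conv_rhs => rw [← re_add_im a]
      simp only [map_add, map_mul, conj_ofReal, conj_I]
      linear_combination (1 / 4) * (a.im : ℂ) * (B u (I • w) - B (I • u) w) * I_mul_I)

lemma sesqPart_apply {E : Type*} [NormedAddCommGroup E] [NormedSpace ℂ E]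
    (B : E →L[ℝ] E →L[ℝ] ℂ) (u w : E) :
    sesqPart B u w =
      (1 / 4) * (B u w + B (I • u) (I • w) + I * (B u (I • w) - B (I • u) w)) := rfl

lemma sesqPart_self_eq_sum {m : ℕ}
    (B : EuclideanSpace ℂ (Fin m) →L[ℝ] EuclideanSpace ℂ (Fin m) →L[ℝ] ℂ)
    (η : EuclideanSpace ℂ (Fin m)) :
    sesqPart B η η = ∑ i, ∑ j,
      sesqPart B (EuclideanSpace.single i 1) (EuclideanSpace.single j 1)
        * η i * (starRingEnd ℂ) (η j) := by
  have hη : η = ∑ i, η i • EuclideanSpace.single i (1 : ℂ) := by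
    simpa using ((EuclideanSpace.basisFun (Fin m) ℂ).sum_repr η).symm
  conv_lhs => rw [hη]
  simp only [map_sum, LinearMap.sum_apply, map_smul, LinearMap.smul_apply, map_smulₛₗ,
    smul_eq_mul, Finset.mul_sum]
  rw [Finset.sum_comm]
  refine Finset.sum_congr rfl fun i _ => Finset.sum_congr rfl fun j _ => ?_
  ring

/-- The Hermitian part of the second derivative, in terms of Wirtinger derivatives. -/
lemma hermitianPart_fderiv_fderiv {m : ℕ} {f : EuclideanSpace ℂ (Fin m) → ℂ}
    {x : EuclideanSpace ℂ (Fin m)} (hf : ContDiffAt ℝ 2 f x) (η : EuclideanSpace ℂ (Fin m)) :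
    (1 / 4) * (fderiv ℝ (fderiv ℝ f) x η η + fderiv ℝ (fderiv ℝ f) x (I • η) (I • η)) =
      ∑ i, ∑ j, wDz i (wDzbar j f) x * η i * (starRingEnd ℂ) (η j) := by
  have hsymm : IsSymmSndFDerivAt ℝ f x := hf.isSymmSndFDerivAt (by simp)
  simp only [wDz_wDzbar_eq hf, ← sesqPart_apply]
  rw [← sesqPart_self_eq_sum, sesqPart_apply, hsymm.eq (I • η) η]
  ring

lemma contDiffAt_sqNormFun {m r : ℕ} {h : EuclideanSpace ℂ (Fin m) → Fin r → Fin r → ℂ}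
    {z : EuclideanSpace ℂ (Fin m)} (hC2 : ∀ ρ σ : Fin r, ContDiffAt ℝ 2 (fun z => h z ρ σ) z)
    (ξ : EuclideanSpace ℂ (Fin r)) : ContDiffAt ℝ 2 (sqNormFun h) (z, ξ) := by
  have hcoord (σ : Fin r) : ContDiff ℝ 2
      (fun p : EuclideanSpace ℂ (Fin m) × EuclideanSpace ℂ (Fin r) => p.2 σ) := by fun_prop
  refine reCLM.contDiff.contDiffAt.comp (z, ξ) (ContDiffAt.sum fun ρ _ => ContDiffAt.sum fun σ _ =>
    (ContDiffAt.mul ?_ (hcoord σ).contDiffAt).mul ?_)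
  · exact (hC2 ρ σ).comp (z, ξ) contDiffAt_fst
  · exact conjCLE.contDiff.contDiffAt.comp (z, ξ) (hcoord ρ).contDiffAt

lemma iteratedFDeriv_two_sqNormFun {m r : ℕ} {h : EuclideanSpace ℂ (Fin m) → Fin r → Fin r → ℂ}
    (hC2 : ∀ ρ σ : Fin r, ContDiffAt ℝ 2 (fun z => h z ρ σ) 0)
    (hid : ∀ ρ σ : Fin r, h 0 ρ σ = if ρ = σ then 1 else 0)
    (hd0 : ∀ ρ σ : Fin r, fderiv ℝ (fun z => h z ρ σ) 0 = 0)
    (ξ ζ : EuclideanSpace ℂ (Fin r)) (η : EuclideanSpace ℂ (Fin m)) :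
    iteratedFDeriv ℝ 2 (sqNormFun h) (0, ξ) ![(η, ζ), (η, ζ)] =
      (∑ ρ, ∑ σ, fderiv ℝ (fderiv ℝ (fun z => h z ρ σ)) 0 η η * ξ σ
        * (starRingEnd ℂ) (ξ ρ)).re + 2 * ∑ ρ, ‖ζ ρ‖ ^ 2 := by
  have hφ := contDiffAt_sqNormFun hC2 ξ
  set q : ℝ → Fin r → ℂ := fun t σ => ξ σ + t * ζ σ with hq
  have hqd (t : ℝ) (σ : Fin r) : HasDerivAt (fun t => q t σ) (ζ σ) t := by
    have hd : HasDerivAt (fun t : ℝ => (t : ℂ) * ζ σ) (ζ σ) t := by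
      simpa using (hasDerivAt_id t).ofReal_comp.mul_const (ζ σ)
    exact hd.const_add (ξ σ)
  have hqc (t : ℝ) (σ : Fin r) : HasDerivAt (fun t => (starRingEnd ℂ) (q t σ))
      ((starRingEnd ℂ) (ζ σ)) t := (hqd t σ).star
  set g : ℝ → ℝ := fun t =>
    (∑ ρ, ∑ σ, ((fderiv ℝ (fun z => h z ρ σ) (0 + t • η) η * q t σ
      + h (0 + t • η) ρ σ * ζ σ) * (starRingEnd ℂ) (q t ρ)
      + h (0 + t • η) ρ σ * q t σ * (starRingEnd ℂ) (ζ ρ))).re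
  have hfirst : ∀ᶠ t in nhds (0 : ℝ),
      HasDerivAt (fun t : ℝ => sqNormFun h ((0, ξ) + t • (η, ζ))) (g t) t := by
    have hall := Filter.eventually_all.2 fun ρ => Filter.eventually_all.2 fun σ =>
      (hC2 ρ σ).eventually_hasDerivAt_line η
    filter_upwards [hall] with t ht
    exact reCLM.hasFDerivAt.comp_hasDerivAt t (HasDerivAt.fun_sum fun ρ _ =>
      HasDerivAt.fun_sum fun σ _ => ((ht ρ σ).fun_mul (hqd t σ)).fun_mul (hqc t ρ))
  have hsecond : HasDerivAt g _ 0 :=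
    reCLM.hasFDerivAt.comp_hasDerivAt (0 : ℝ) (HasDerivAt.fun_sum fun ρ _ =>
      HasDerivAt.fun_sum fun σ _ =>
        (((((hC2 ρ σ).hasDerivAt_fderiv_line η).fun_mul (hqd 0 σ)).fun_add
          (((hC2 ρ σ).eventually_hasDerivAt_line η).self_of_nhds.mul_const (ζ σ))).fun_mul
            (hqc 0 ρ)).fun_add
          ((((hC2 ρ σ).eventually_hasDerivAt_line η).self_of_nhds.fun_mul (hqd 0 σ)).mul_const
            ((starRingEnd ℂ) (ζ ρ))))
  have heq : (fun t : ℝ => fderiv ℝ (sqNormFun h) ((0, ξ) + t • (η, ζ)) (η, ζ)) =ᶠ[nhds 0] g := by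
    filter_upwards [hfirst, hφ.eventually_hasDerivAt_line (η, ζ)] with t h1 h2
    exact h2.unique h1
  rw [iteratedFDeriv_two_apply]
  refine ((hφ.hasDerivAt_fderiv_line (η, ζ)).unique (hsecond.congr_of_eventuallyEq heq)).trans ?_
  simp [hq, hd0, hid, Finset.sum_add_distrib, ← normSq_eq_norm_sq, normSq_apply]
  ring

lemma sum_sum_sum_comm {α β γ M : Type*} [Fintype α] [Fintype β] [Fintype γ] [AddCommMonoid M]
    (f : α → β → γ → M) : ∑ a, ∑ b, ∑ c, f a b c = ∑ b, ∑ c, ∑ a, f a b c := by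
  rw [Finset.sum_comm]
  exact Finset.sum_congr rfl fun b _ => Finset.sum_comm

lemma leviForm_sqNormFun {m r : ℕ} {h : EuclideanSpace ℂ (Fin m) → Fin r → Fin r → ℂ}
    (hC2 : ∀ ρ σ : Fin r, ContDiffAt ℝ 2 (fun z => h z ρ σ) 0)
    (hid : ∀ ρ σ : Fin r, h 0 ρ σ = if ρ = σ then 1 else 0)
    (hd0 : ∀ ρ σ : Fin r, fderiv ℝ (fun z => h z ρ σ) 0 = 0)
    (ξ ζ : EuclideanSpace ℂ (Fin r)) (η : EuclideanSpace ℂ (Fin m)) :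
    leviForm (sqNormFun h) (0, ξ) (η, ζ) =
      (∑ i, ∑ j, (∑ ρ, ∑ σ, wDz i (wDzbar j (fun z => h z ρ σ)) 0 * ξ σ
        * (starRingEnd ℂ) (ξ ρ)) * η i * (starRingEnd ℂ) (η j)).re + ∑ ρ, ‖ζ ρ‖ ^ 2 := by
  have hsum : ∑ i, ∑ j, (∑ ρ, ∑ σ, wDz i (wDzbar j (fun z => h z ρ σ)) 0 * ξ σ
        * (starRingEnd ℂ) (ξ ρ)) * η i * (starRingEnd ℂ) (η j) =
      ((1 / 4 : ℝ) : ℂ) * (∑ ρ, ∑ σ, fderiv ℝ (fderiv ℝ (fun z => h z ρ σ)) 0 η η * ξ σ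
          * (starRingEnd ℂ) (ξ ρ)
        + ∑ ρ, ∑ σ, fderiv ℝ (fderiv ℝ (fun z => h z ρ σ)) 0 (I • η) (I • η) * ξ σ
          * (starRingEnd ℂ) (ξ ρ)) := by
    have hterm (ρ σ : Fin r) := hermitianPart_fderiv_fderiv (hC2 ρ σ) η
    calc _ = ∑ i, ∑ j, ∑ ρ, ∑ σ, wDz i (wDzbar j (fun z => h z ρ σ)) 0 * η i
          * (starRingEnd ℂ) (η j) * (ξ σ * (starRingEnd ℂ) (ξ ρ)) := by
          simp only [Finset.sum_mul]
          refine Finset.sum_congr rfl fun i _ => Finset.sum_congr rfl fun j _ =>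
            Finset.sum_congr rfl fun ρ _ => Finset.sum_congr rfl fun σ _ => ?_
          ring
      _ = ∑ ρ, ∑ σ, ∑ i, ∑ j, wDz i (wDzbar j (fun z => h z ρ σ)) 0 * η i
          * (starRingEnd ℂ) (η j) * (ξ σ * (starRingEnd ℂ) (ξ ρ)) := by
          exact (Finset.sum_congr rfl fun i _ => sum_sum_sum_comm _).trans (sum_sum_sum_comm _)
      _ = _ := by
          simp_rw [← Finset.sum_add_distrib, Finset.mul_sum, ← Finset.sum_mul, ← hterm]
          refine Finset.sum_congr rfl fun ρ _ => Finset.sum_congr rfl fun σ _ => ?_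
          push_cast
          ring
  rw [hsum, re_ofReal_mul, add_re, leviForm, Prod.smul_mk,
    iteratedFDeriv_two_sqNormFun hC2 hid hd0, iteratedFDeriv_two_sqNormFun hC2 hid hd0]
  simp only [PiLp.smul_apply, norm_smul, norm_I, one_mul]
  ring

/-- A Hermitian form is a sum of squares, weighted by the eigenvalues, in unitary coordinates. -/
lemma Matrix.IsHermitian.exists_diagonalization {m : ℕ} {A : Matrix (Fin m) (Fin m) ℂ}
    (hA : A.IsHermitian) : ∃ e : EuclideanSpace ℂ (Fin m) ≃ₗ[ℂ] (Fin m → ℂ),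
      ∀ η, ∑ i, ∑ j, A i j * η i * (starRingEnd ℂ) (η j) =
        ((∑ k, hA.eigenvalues k * ‖e η k‖ ^ 2 : ℝ) : ℂ) := by
  set U : Matrix (Fin m) (Fin m) ℂ := hA.eigenvectorUnitary.val with hU
  have hUU : U * star U = 1 := Unitary.coe_mul_star_self hA.eigenvectorUnitary
  have hUU' : star U * U = 1 := Unitary.coe_star_mul_self hA.eigenvectorUnitary
  have hT : U.transpose * (star U).transpose = 1 := by
    rw [← Matrix.transpose_mul, hUU', Matrix.transpose_one]
  have hT' : (star U).transpose * U.transpose = 1 := by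
    rw [← Matrix.transpose_mul, hUU, Matrix.transpose_one]
  refine ⟨(WithLp.linearEquiv 2 ℂ (Fin m → ℂ)).trans (Matrix.toLin'OfInv hT' hT), fun η => ?_⟩
  have hAij (i j : Fin m) :
      A i j = ∑ k, U i k * (hA.eigenvalues k : ℂ) * (starRingEnd ℂ) (U j k) := by
    conv_lhs => rw [hA.spectral_theorem]
    rw [Unitary.conjStarAlgAut_apply, Matrix.mul_apply]
    simp [← hU, Matrix.mul_diagonal, Matrix.star_apply]
  have he (k : Fin m) : ((WithLp.linearEquiv 2 ℂ (Fin m → ℂ)).trans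
      (Matrix.toLin'OfInv hT' hT)) η k = ∑ i, U i k * η i := by
    simp [Matrix.mulVec, dotProduct]
  simp only [he]
  push_cast
  simp only [← conj_mul', map_sum, map_mul, hAij, Finset.sum_mul, Finset.mul_sum]
  refine Eq.trans ?_ (sum_sum_sum_comm _).symm
  refine Finset.sum_congr rfl fun i _ => Finset.sum_congr rfl fun j _ =>
    Finset.sum_congr rfl fun k _ => ?_
  ring

lemma card_subtype_sum {α β : Type*} [Fintype α] [Fintype β] (P : α ⊕ β → Prop)
    [DecidablePred P] : Fintype.card {k // P k} =
      Fintype.card {a // P (Sum.inl a)} + Fintype.card {b // P (Sum.inr b)} := by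
  rw [Fintype.card_congr (Equiv.subtypeSum (p := P)), Fintype.card_sum]

lemma card_pos_add_card_neg_add_card_zero {ι : Type*} [Fintype ι] (d : ι → ℝ) :
    Fintype.card {k // 0 < d k} + Fintype.card {k // d k < 0} + Fintype.card {k // d k = 0} =
      Fintype.card ι := by
  rw [Fintype.card_subtype, Fintype.card_subtype, Fintype.card_subtype, Finset.card_filter,
    Finset.card_filter, Finset.card_filter, ← Finset.sum_add_distrib, ← Finset.sum_add_distrib,
    ← Finset.card_univ, Finset.card_eq_sum_ones]
  refine Finset.sum_congr rfl fun k _ => ?_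
  rcases lt_trichotomy (d k) 0 with hk | hk | hk
  · simp [hk, hk.not_gt, hk.ne]
  · simp [hk]
  · simp [hk, hk.not_gt, hk.ne']

/-- Proposition 6.2(ii), pointwise special-frame version: if the curvature matrix `A`
at `ξ₀` has `s` positive and `t` negative eigenvalues, then the Levi form of the
squared-norm function at `(0, ξ₀)` has exactly `t + r` positive, `s` negative and
`m - s - t` zero eigenvalues. -/
theorem levi_form_signature_of_hermitian_metric
    {m r : ℕ} (hm : 1 ≤ m) (hr : 1 ≤ r)
    {W : Set (EuclideanSpace ℂ (Fin m))} (hW : IsOpen W)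
    (h0W : (0 : EuclideanSpace ℂ (Fin m)) ∈ W)
    {h : EuclideanSpace ℂ (Fin m) → Fin r → Fin r → ℂ}
    (hC2 : ∀ ρ σ : Fin r, ContDiffOn ℝ 2 (fun z => h z ρ σ) W)
    (hherm : ∀ z ∈ W, ∀ ρ σ : Fin r, h z ρ σ = (starRingEnd ℂ) (h z σ ρ))
    (hid : ∀ ρ σ : Fin r, h 0 ρ σ = if ρ = σ then 1 else 0)
    (hd0 : ∀ ρ σ : Fin r, fderiv ℝ (fun z => h z ρ σ) 0 = 0)
    {ξ₀ : EuclideanSpace ℂ (Fin r)} (hξ₀ : ξ₀ ≠ 0)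
    {A : Matrix (Fin m) (Fin m) ℂ}
    (hAdef : ∀ i j : Fin m, A i j =
      -∑ ρ : Fin r, ∑ σ : Fin r,
        wDz i (wDzbar j (fun z => h z ρ σ)) 0 * ξ₀ σ * (starRingEnd ℂ) (ξ₀ ρ))
    (hA : A.IsHermitian)
    {s t : ℕ}
    (hs : Fintype.card {i // 0 < hA.eigenvalues i} = s)
    (ht : Fintype.card {i // hA.eigenvalues i < 0} = t) :
    -- exactly `t + r` positive eigenvalues
    ((∃ V : Submodule ℂ (EuclideanSpace ℂ (Fin m) × EuclideanSpace ℂ (Fin r)),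
        Module.finrank ℂ V = t + r ∧
        ∀ v ∈ V, v ≠ 0 → 0 < leviForm (sqNormFun h) (0, ξ₀) v) ∧
      (∀ V : Submodule ℂ (EuclideanSpace ℂ (Fin m) × EuclideanSpace ℂ (Fin r)),
        (∀ v ∈ V, v ≠ 0 → 0 < leviForm (sqNormFun h) (0, ξ₀) v) →
          Module.finrank ℂ V ≤ t + r)) ∧
    -- exactly `s` negative eigenvalues
    ((∃ V : Submodule ℂ (EuclideanSpace ℂ (Fin m) × EuclideanSpace ℂ (Fin r)),
        Module.finrank ℂ V = s ∧
        ∀ v ∈ V, v ≠ 0 → leviForm (sqNormFun h) (0, ξ₀) v < 0) ∧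
      (∀ V : Submodule ℂ (EuclideanSpace ℂ (Fin m) × EuclideanSpace ℂ (Fin r)),
        (∀ v ∈ V, v ≠ 0 → leviForm (sqNormFun h) (0, ξ₀) v < 0) →
          Module.finrank ℂ V ≤ s)) ∧
    -- exactly `m - s - t` zero eigenvalues: the kernel of the polarized Levi form
    -- is a complex subspace of dimension `m - s - t`
    (∃ V : Submodule ℂ (EuclideanSpace ℂ (Fin m) × EuclideanSpace ℂ (Fin r)),
      (V : Set (EuclideanSpace ℂ (Fin m) × EuclideanSpace ℂ (Fin r))) =
        {v | ∀ w, leviForm (sqNormFun h) (0, ξ₀) (v + w) =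
              leviForm (sqNormFun h) (0, ξ₀) v + leviForm (sqNormFun h) (0, ξ₀) w ∧
            leviForm (sqNormFun h) (0, ξ₀) (v + Complex.I • w) =
              leviForm (sqNormFun h) (0, ξ₀) v + leviForm (sqNormFun h) (0, ξ₀) w} ∧
      Module.finrank ℂ V = m - s - t) := by
  have hC2' (ρ σ : Fin r) : ContDiffAt ℝ 2 (fun z => h z ρ σ) 0 :=
    (hC2 ρ σ).contDiffAt (hW.mem_nhds h0W)
  obtain ⟨e₁, he₁⟩ := hA.exists_diagonalization
  set e : (EuclideanSpace ℂ (Fin m) × EuclideanSpace ℂ (Fin r)) ≃ₗ[ℂ] (Fin m ⊕ Fin r → ℂ) :=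
    (e₁.prodCongr (WithLp.linearEquiv 2 ℂ (Fin r → ℂ))).trans
      (LinearEquiv.sumArrowLequivProdArrow (Fin m) (Fin r) ℂ ℂ).symm with he
  set d : Fin m ⊕ Fin r → ℝ := Sum.elim (fun k => -hA.eigenvalues k) (fun _ => 1) with hd
  have hL (v : EuclideanSpace ℂ (Fin m) × EuclideanSpace ℂ (Fin r)) :
      leviForm (sqNormFun h) (0, ξ₀) v = ∑ k, d k * ‖e v k‖ ^ 2 := by
    obtain ⟨η, ζ⟩ := v
    have hsum : ∑ i, ∑ j, (∑ ρ, ∑ σ, wDz i (wDzbar j (fun z => h z ρ σ)) 0 * ξ₀ σ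
        * (starRingEnd ℂ) (ξ₀ ρ)) * η i * (starRingEnd ℂ) (η j) =
        -∑ i, ∑ j, A i j * η i * (starRingEnd ℂ) (η j) := by
      simp [hAdef]
    rw [leviForm_sqNormFun hC2' hid hd0, hsum, he₁, neg_re, ofReal_re, Fintype.sum_sum_type]
    simp [he, hd]
  have hpos : Fintype.card {k // 0 < d k} = t + r := by
    simp [card_subtype_sum, hd, ht]
  have hneg : Fintype.card {k // 0 < -d k} = s := by
    simp [card_subtype_sum, hd, hs, zero_lt_one.not_gt]
  have hzero : Fintype.card {k // d k = 0} = m - s - t := by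
    have hcard := card_pos_add_card_neg_add_card_zero hA.eigenvalues
    rw [hs, ht, Fintype.card_fin] at hcard
    simp only [card_subtype_sum, hd, Sum.elim_inl, Sum.elim_inr, neg_eq_zero, one_ne_zero,
      Fintype.card_eq_zero, add_zero]
    omega
  have hLneg (v : EuclideanSpace ℂ (Fin m) × EuclideanSpace ℂ (Fin r)) :
      leviForm (sqNormFun h) (0, ξ₀) v < 0 ↔ 0 < ∑ k, -d k * ‖e v k‖ ^ 2 := by
    rw [hL, ← neg_pos, ← Finset.sum_neg_distrib]
    simp only [neg_mul]
  refine ⟨⟨?_, fun V hV => ?_⟩, ⟨?_, fun V hV => ?_⟩, coordSubspace e (fun k => d k = 0),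
    coe_coordSubspace_eq_radical e d _ hL, ?_⟩
  · simpa only [hL, hpos] using exists_posDef_subspace e d
  · simpa only [hpos] using finrank_le_of_posDef e d V (by simpa only [hL] using hV)
  · simpa only [hLneg, hneg] using exists_posDef_subspace e (fun k => -d k)
  · simpa only [hneg] using
      finrank_le_of_posDef e (fun k => -d k) V (by simpa only [hLneg] using hV)
  · rw [finrank_coordSubspace, hzero]

end
end
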